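/- arXiv:1907.05445 — 2 statements merged into one kernel-verified Lean document; each statement's English description precedes it below -/
import Mathlib

section
/- Let G be a finite connected distance-hereditary graph. If a vertex v is a furthest vertex from some vertex u (i.e., v ∈ F(u) for some u ∈ V), then e(v) ≥ diam(G) − 2. -/
/-- A graph is distance-hereditary if every connected induced subgraph is isometric
(equivalently, every induced path is a shortest path). -/
def DistHereditary {V : Type*} (G : SimpleGraph V) : Prop :=
  ∀ s : Set V, (G.induce s).Connected →
    ∀ u v : s, (G.induce s).dist u v = G.dist (u : V) (v : V)

/-- Eccentricity of a vertex: `e(v) = max_{u} d(v,u)`. -/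
noncomputable def ecc {V : Type*} [Fintype V] (G : SimpleGraph V) (v : V) : ℕ :=
  Finset.univ.sup (fun u => G.dist v u)

/-- Radius: minimum eccentricity. -/
noncomputable def rad {V : Type*} [Fintype V] (G : SimpleGraph V) : ℕ :=
  sInf (Set.range (ecc G))

/-- Diameter: maximum eccentricity. -/
noncomputable def diam {V : Type*} [Fintype V] (G : SimpleGraph V) : ℕ :=
  Finset.univ.sup (fun v => ecc G v)

/-- The center: vertices of minimum eccentricity. -/
def center {V : Type*} [Fintype V] (G : SimpleGraph V) : Set V :=
  {v | ecc G v = rad G}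

/-- Distance from a vertex to a set of vertices: `d(v,S) = min_{s ∈ S} d(v,s)`. -/
noncomputable def distToSet {V : Type*} (G : SimpleGraph V) (v : V) (S : Set V) : ℕ :=
  sInf ((G.dist v) '' S)

/-- The interval `I(x,y)`: vertices on shortest `(x,y)`-paths. -/
def interval {V : Type*} (G : SimpleGraph V) (x y : V) : Set V :=
  {v | G.dist x v + G.dist v y = G.dist x y}

/-- The intervalSlice `S_k(x,y) = {v ∈ I(x,y) : d(x,v) = k}`. -/
def intervalSlice {V : Type*} (G : SimpleGraph V) (x y : V) (k : ℕ) : Set V :=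
  {v | v ∈ interval G x y ∧ G.dist x v = k}

/-- The set `S` induces a cograph in `G`: no induced path on four vertices within `S`. -/
def IsCographOn {V : Type*} (G : SimpleGraph V) (S : Set V) : Prop :=
  ¬ ∃ a b c d : V, a ∈ S ∧ b ∈ S ∧ c ∈ S ∧ d ∈ S ∧
    a ≠ c ∧ a ≠ d ∧ b ≠ d ∧
    G.Adj a b ∧ G.Adj b c ∧ G.Adj c d ∧ ¬ G.Adj a c ∧ ¬ G.Adj a d ∧ ¬ G.Adj b d

section

open SimpleGraph

variable {V : Type*} {G : SimpleGraph V}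

/-- A function dropping by at most one along every edge drops by at most `dist` overall. -/
lemma le_add_dist_of_adj (hG : G.Connected) (f : V → ℤ)
    (hf : ∀ a b, G.Adj a b → f a ≤ f b + 1) (a b : V) : f a ≤ f b + G.dist a b := by
  have key : ∀ {a b : V} (p : G.Walk a b), f a ≤ f b + p.length := by
    intro a b p
    induction p with
    | nil => simp
    | cons h p ih =>
      have := hf _ _ h
      rw [Walk.length_cons]
      push_cast
      linarith
  obtain ⟨p, hp⟩ := hG.exists_walk_length_eq_dist a b
  rw [← hp]
  exact key p

lemma dist_getVert_add_le (hG : G.Connected) {a b : V} (p : G.Walk a b) (i k : ℕ) :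
    G.dist (p.getVert i) (p.getVert (i + k)) ≤ k := by
  induction k with
  | zero => simp
  | succ k ih =>
    have htri := hG.dist_triangle (u := p.getVert i) (v := p.getVert (i + k))
      (w := p.getVert (i + k + 1))
    have hstep : G.dist (p.getVert (i + k)) (p.getVert (i + k + 1)) ≤ 1 := by
      rcases lt_or_ge (i + k) p.length with h | h
      · exact (dist_eq_one_iff_adj.2 (p.adj_getVert_succ h)).le
      · rw [p.getVert_of_length_le h, p.getVert_of_length_le (by omega), dist_self]
        omega
    rw [← add_assoc]
    omega

lemma dist_getVert_of_length_eq_dist (hG : G.Connected) {a b : V} (p : G.Walk a b)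
    (hp : p.length = G.dist a b) {i : ℕ} (hi : i ≤ p.length) :
    G.dist a (p.getVert i) = i ∧ G.dist (p.getVert i) b = p.length - i := by
  have h₁ := dist_getVert_add_le hG p 0 i
  have h₂ := dist_getVert_add_le hG p i (p.length - i)
  rw [Nat.add_sub_cancel' hi, Walk.getVert_length] at h₂
  rw [zero_add, Walk.getVert_zero] at h₁
  have := hG.dist_triangle (u := a) (v := p.getVert i) (w := b)
  omega

/-- The vertex set of a shortest path. -/
lemma exists_geodesic_set (hG : G.Connected) (x y : V) :
    ∃ P : Set V, (G.induce P).Connected ∧ x ∈ P ∧ y ∈ P ∧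
      (∀ z ∈ P, G.dist x z + G.dist y z = G.dist x y) ∧
      ∀ z ∈ P, ∀ z' ∈ P, G.dist x z ≤ G.dist x z' → G.dist x z + G.dist z z' ≤ G.dist x z' := by
  obtain ⟨p, hp⟩ := hG.exists_walk_length_eq_dist x y
  refine ⟨{z | z ∈ p.support}, p.connected_induce_support, p.start_mem_support,
    p.end_mem_support, ?_, ?_⟩
  · intro z hz
    obtain ⟨i, rfl, hi⟩ := Walk.mem_support_iff_exists_getVert.1 hz
    have := dist_getVert_of_length_eq_dist hG p hp hi
    rw [dist_comm (u := y)]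
    omega
  · intro z hz z' hz' hle
    obtain ⟨i, rfl, hi⟩ := Walk.mem_support_iff_exists_getVert.1 hz
    obtain ⟨j, rfl, hj⟩ := Walk.mem_support_iff_exists_getVert.1 hz'
    have h₁ := dist_getVert_of_length_eq_dist hG p hp hi
    have h₂ := dist_getVert_of_length_eq_dist hG p hp hj
    have h₃ := dist_getVert_add_le hG p i (j - i)
    rw [Nat.add_sub_cancel' (by omega)] at h₃
    omega

/-- If `w` is the last vertex before a connected set `P` on a shortest path from `u` to `P`, then
the distance from `u` to a vertex `x` of `P` is realised through a neighbour of `w` in `P`. -/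
lemma DistHereditary.exists_gate (hG : G.Connected) (hdh : DistHereditary G) {P : Set V}
    (hP : (G.induce P).Connected) {u q : V} (hq : q ∈ P) (hu : u ∉ P)
    (hmin : ∀ z ∈ P, G.dist u q ≤ G.dist u z) :
    ∃ w, G.dist u w + 1 = G.dist u q ∧ ∀ x ∈ P, ∃ p ∈ P, G.Adj w p ∧
      G.dist u q + G.dist x p ≤ G.dist u x := by
  classical
  obtain ⟨r, hr⟩ := hG.exists_walk_length_eq_dist u q
  have hpos : 0 < G.dist u q := hG.pos_dist_of_ne (by rintro rfl; exact hu hq)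
  set w := r.getVert (r.length - 1) with hw
  have hdw : G.dist u w = r.length - 1 :=
    (dist_getVert_of_length_eq_dist hG r hr (by omega)).1
  have hwq : G.Adj w q := by
    have := r.adj_getVert_succ (i := r.length - 1) (by omega)
    rwa [Nat.sub_add_cancel (by omega), Walk.getVert_length] at this
  refine ⟨w, by omega, fun x hx => ?_⟩
  obtain ⟨p, ⟨hpP, hwp⟩, hpmin⟩ := exists_minimalFor_of_wellFoundedLT
    (fun p => p ∈ P ∧ G.Adj w p) (G.dist x) ⟨q, hq, hwq⟩
  refine ⟨p, hpP, hwp, ?_⟩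
  have hpmin' : ∀ z ∈ P, G.Adj w z → G.dist x p ≤ G.dist x z := fun z hz hwz => by
    by_contra hlt
    exact hlt (hpmin ⟨hz, hwz⟩ (by omega))
  have hnear : ∀ z ∈ P, G.Adj w z → G.dist x z ≤ G.dist x p + 2 := fun z _ hwz => by
    have h₁ := hG.dist_triangle (u := x) (v := p) (w := z)
    have h₂ := hG.dist_triangle (u := p) (v := w) (w := z)
    have h₃ := dist_eq_one_iff_adj.2 hwp.symm
    have h₄ := dist_eq_one_iff_adj.2 hwz
    omega
  have hcross : ∀ z ∈ r.support, z ∉ P → ∀ z' ∈ P, G.Adj z z' → z = w := by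
    intro z hz hzP z' hz' hadj
    obtain ⟨i, rfl, hi⟩ := Walk.mem_support_iff_exists_getVert.1 hz
    have h₁ := (dist_getVert_of_length_eq_dist hG r hr hi).1
    have h₂ := hG.dist_triangle (u := u) (v := r.getVert i) (w := z')
    have h₃ := dist_eq_one_iff_adj.2 hadj
    have h₄ := hmin z' hz'
    have h₅ : i ≠ r.length := by
      rintro rfl
      exact hzP (by rwa [Walk.getVert_length])
    rw [hw, show i = r.length - 1 by omega]
  have hS : (G.induce ({z | z ∈ r.support} ∪ P)).Connected :=
    induce_union_connected r.connected_induce_support.preconnected hP.preconnected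
      ⟨q, r.end_mem_support, hq⟩
  let φ : V → ℤ := fun z =>
    if z ∈ P then (G.dist x z : ℤ) else G.dist x p + G.dist u q - G.dist u z
  have hφ := le_add_dist_of_adj hS (fun z => φ z) (by
    rintro ⟨a, ha⟩ ⟨b, hb⟩ hab
    replace hab : G.Adj a b := hab
    have hab₁ := dist_eq_one_iff_adj.2 hab
    by_cases haP : a ∈ P <;> by_cases hbP : b ∈ P <;> simp only [φ, haP, hbP, if_true, if_false]
    · have := hG.dist_triangle (u := x) (v := b) (w := a)
      rw [dist_comm (u := b), hab₁] at this
      omega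
    · have hbw := hcross b (hb.resolve_right hbP) hbP a haP hab.symm
      have := hnear a haP (hbw ▸ hab.symm)
      rw [hbw]
      omega
    · have haw := hcross a (ha.resolve_right haP) haP b hbP hab
      have := hpmin' b hbP (haw ▸ hab)
      rw [haw]
      omega
    · have := hG.dist_triangle (u := u) (v := a) (w := b)
      omega) ⟨u, Or.inl r.start_mem_support⟩ ⟨x, Or.inr hx⟩
  rw [hdh _ hS] at hφ
  simp only [φ, hu, hx, if_true, if_false, dist_self] at hφ
  omega

/-- Every vertex `u` projects onto a shortest `(x,y)`-path in a pair of vertices at distance at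
most two, through which it reaches `x` and `y` respectively. -/
lemma DistHereditary.exists_projection (hG : G.Connected) (hdh : DistHereditary G) {P : Set V}
    (hP : (G.induce P).Connected) {x y : V} (hx : x ∈ P) (hy : y ∈ P) (u : V) :
    ∃ s : ℕ, ∃ a ∈ P, ∃ b ∈ P, G.dist a b ≤ 2 ∧ G.dist u a ≤ s ∧ G.dist u b ≤ s ∧
      s + G.dist x a ≤ G.dist u x ∧ s + G.dist y b ≤ G.dist u y := by
  by_cases hu : u ∈ P
  · exact ⟨0, u, hu, u, hu, by simp [G.dist_comm (v := u)]⟩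
  obtain ⟨q, hq, hqmin⟩ := exists_minimalFor_of_wellFoundedLT (· ∈ P) (G.dist u) ⟨x, hx⟩
  obtain ⟨w, hw, hgate⟩ := hdh.exists_gate hG hP hq hu fun z hz => by
    by_contra hlt
    exact hlt (hqmin hz (by omega))
  obtain ⟨a, ha, hwa, hxa⟩ := hgate x hx
  obtain ⟨b, hb, hwb, hyb⟩ := hgate y hy
  have h₁ := hG.dist_triangle (u := a) (v := w) (w := b)
  have h₂ := hG.dist_triangle (u := u) (v := w) (w := a)
  have h₃ := hG.dist_triangle (u := u) (v := w) (w := b)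
  have h₄ := dist_eq_one_iff_adj.2 hwa
  have h₅ := dist_eq_one_iff_adj.2 hwb
  have h₆ := dist_comm (G := G) (u := a) (v := w)
  exact ⟨G.dist u q, a, ha, b, hb, by omega, by omega, by omega, hxa, hyb⟩

/-- Four-point inequality for distance-hereditary graphs. -/
lemma DistHereditary.dist_add_dist_le (hG : G.Connected) (hdh : DistHereditary G)
    (u v x y : V) :
    G.dist u v + G.dist x y ≤
      max (G.dist u x + G.dist v y) (G.dist u y + G.dist v x) + 2 := by
  obtain ⟨P, hP, hx, hy, hsum, hgeo⟩ := exists_geodesic_set hG x y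
  obtain ⟨s, a, ha, b, hb, hab, hua, hub, hxa, hyb⟩ := hdh.exists_projection hG hP hx hy u
  obtain ⟨t, c, hc, d, hd, hcd, hvc, hvd, hxc, hyd⟩ := hdh.exists_projection hG hP hx hy v
  have hvia : ∀ {e f : V}, e ∈ P → f ∈ P → G.dist u e ≤ s → G.dist v f ≤ t →
      (G.dist u v : ℤ) ≤ s + t + max (G.dist x e - G.dist x f : ℤ) (G.dist x f - G.dist x e) := by
    intro e f he hf hue hvf
    have h₁ := hG.dist_triangle (u := u) (v := e) (w := v)
    have h₂ := hG.dist_triangle (u := e) (v := f) (w := v)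
    have h₃ := dist_comm (G := G) (u := f) (v := v)
    have h₄ := dist_comm (G := G) (u := f) (v := e)
    rcases le_total (G.dist x e) (G.dist x f) with h | h
    · have := hgeo e he f hf h
      omega
    · have := hgeo f hf e he h
      omega
  have h₁ := hvia ha hc hua hvc
  have h₂ := hvia ha hd hua hvd
  have h₃ := hvia hb hc hub hvc
  have h₄ := hvia hb hd hub hvd
  have h₅ := hsum b hb
  have h₆ := hsum d hd
  have h₇ := hG.dist_triangle (u := x) (v := a) (w := b)
  have h₈ := hG.dist_triangle (u := x) (v := c) (w := d)
  omega

lemma dist_le_ecc [Fintype V] (a b : V) : G.dist a b ≤ ecc G a :=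
  Finset.le_sup (f := fun z => G.dist a z) (Finset.mem_univ b)

end

/-- In a finite connected distance-hereditary graph, any vertex `v` furthest
from some vertex `u` (i.e. `v ∈ F(u)`) satisfies `e(v) ≥ diam(G) − 2`. -/
theorem furthest_vertex_close_to_diameter {V : Type*} [Fintype V] (G : SimpleGraph V)
    (hconn : G.Connected) (hdh : DistHereditary G) (u v : V)
    (hv : G.dist u v = ecc G u) :
    diam G ≤ ecc G v + 2 := by
  refine Finset.sup_le fun x _ => Finset.sup_le fun y _ => ?_
  have h := hdh.dist_add_dist_le hconn u v x y
  have hux := dist_le_ecc (G := G) u x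
  have huy := dist_le_ecc (G := G) u y
  have hvx := dist_le_ecc (G := G) v x
  have hvy := dist_le_ecc (G := G) v y
  omega
end

section
/- Let G be a finite connected distance-hereditary graph, let x,y be a mutually distant pair of vertices, and let u be any vertex. (i) If |d(x,u) − d(y,u)| ≥ 2, then e(u) = max{d(x,u), d(y,u)}. (ii) If |d(x,u) − d(y,u)| = 1 or u ∈ C(G), then max{d(x,u), d(y,u)} ≤ e(u) ≤ max{d(x,u), d(y,u)} + 1. -/
section DistanceHereditary

open SimpleGraph

variable {V : Type*} {G : SimpleGraph V}

/-- The vertex set of a shortest path from `a` to `b`. -/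
lemma exists_connected_subset_interval (hconn : G.Connected) (a b : V) :
    ∃ S : Set V, (G.induce S).Connected ∧ a ∈ S ∧ b ∈ S ∧ S ⊆ interval G a b := by
  classical
  obtain ⟨p, hp⟩ := hconn.exists_walk_length_eq_dist a b
  refine ⟨{v | v ∈ p.support}, p.connected_induce_support, p.start_mem_support,
    p.end_mem_support, fun w hw => ?_⟩
  have hlen := congrArg Walk.length (p.take_spec hw)
  rw [Walk.length_append] at hlen
  have h₁ := dist_le (p.takeUntil w hw)
  have h₂ := dist_le (p.dropUntil w hw)
  have h₃ := hconn.dist_triangle (u := a) (v := w) (w := b)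
  change G.dist a w + G.dist w b = G.dist a b
  omega

lemma exists_mem_intervalSlice (hconn : G.Connected) (a b : V) {k : ℕ} (hk : k ≤ G.dist a b) :
    ∃ c, c ∈ intervalSlice G a b k := by
  obtain ⟨p, hp⟩ := hconn.exists_walk_length_eq_dist a b
  have h₁ := dist_le (p.take k)
  have h₂ := dist_le (p.drop k)
  rw [Walk.take_length] at h₁
  rw [Walk.drop_length] at h₂
  have h₃ := hconn.dist_triangle (u := a) (v := p.getVert k) (w := b)
  refine ⟨p.getVert k, ?_, ?_⟩
  · change G.dist a _ + G.dist _ b = G.dist a b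
    omega
  · omega

/-- A walk inside `U ∪ W` from `U` to `W` passes from `U` to `W` in at most one step. -/
lemma exists_crossing_of_walk (hconn : G.Connected) {U W : Set V} {a b : ↥(U ∪ W)}
    (p : (G.induce (U ∪ W)).Walk a b) (ha : (a : V) ∈ U) (hb : (b : V) ∈ W) :
    ∃ s ∈ U, ∃ t ∈ W, G.dist s t ≤ 1 ∧
      G.dist a s + G.dist s t + G.dist t b ≤ p.length := by
  induction p with
  | nil => exact ⟨_, ha, _, hb, by simp⟩
  | @cons a a' b h p ih =>
    have hadj : G.Adj a a' := h
    have h1 := dist_eq_one_iff_adj.mpr hadj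
    by_cases ha' : (a' : V) ∈ U
    · obtain ⟨s, hs, t, ht, hst, hlen⟩ := ih ha' hb
      refine ⟨s, hs, t, ht, hst, ?_⟩
      have := hconn.dist_triangle (u := (a : V)) (v := a') (w := s)
      rw [Walk.length_cons]
      omega
    · refine ⟨a, ha, a', a'.2.resolve_left ha', h1.le, ?_⟩
      have hle := dist_le (p.map (Embedding.induce (U ∪ W)).toHom)
      rw [Walk.length_map] at hle
      have hle' : G.dist a' b ≤ p.length := hle
      rw [Walk.length_cons, dist_self]
      omega

/-- Some shortest path between two intersecting connected sets is the concatenation of a part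
leading to the first set, at most one edge, and a part leaving from the second set. -/
lemma DistHereditary.exists_crossing (hconn : G.Connected) (hdh : DistHereditary G)
    {U W : Set V} (hU : (G.induce U).Connected) (hW : (G.induce W).Connected)
    (hUW : (U ∩ W).Nonempty) {a b : V} (ha : a ∈ U) (hb : b ∈ W) :
    ∃ s ∈ U, ∃ t ∈ W, G.dist s t ≤ 1 ∧
      G.dist a s + G.dist s t + G.dist t b = G.dist a b := by
  have hc := induce_union_connected hU.preconnected hW.preconnected hUW
  obtain ⟨p, hp⟩ := hc.exists_walk_length_eq_dist ⟨a, Or.inl ha⟩ ⟨b, Or.inr hb⟩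
  rw [hdh _ hc] at hp
  obtain ⟨s, hs, t, ht, hst, hlen⟩ := exists_crossing_of_walk hconn p ha hb
  refine ⟨s, hs, t, ht, hst, ?_⟩
  have h₁ := hconn.dist_triangle (u := a) (v := s) (w := b)
  have h₂ := hconn.dist_triangle (u := s) (v := t) (w := b)
  simp only at hlen hp
  omega

/-- A crossing between a shortest path from `x` to `u` and the concatenation of shortest paths
from `x` to `p` and from `p` to `y`. -/
lemma DistHereditary.exists_crossing_through (hconn : G.Connected) (hdh : DistHereditary G)
    (x u p y : V) :
    ∃ s ∈ interval G x u, ∃ t, (t ∈ interval G x p ∨ t ∈ interval G p y) ∧ G.dist s t ≤ 1 ∧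
      G.dist u s + G.dist s t + G.dist t y = G.dist u y := by
  obtain ⟨U, hU, hxU, huU, hUI⟩ := exists_connected_subset_interval hconn x u
  obtain ⟨P, hP, hxP, hpP, hPI⟩ := exists_connected_subset_interval hconn x p
  obtain ⟨Q, hQ, hpQ, hyQ, hQI⟩ := exists_connected_subset_interval hconn p y
  obtain ⟨s, hs, t, ht, hst⟩ := hdh.exists_crossing hconn hU
    (induce_union_connected hP.preconnected hQ.preconnected ⟨p, hpP, hpQ⟩)
    ⟨x, hxU, Or.inl hxP⟩ huU (Or.inr hyQ)
  exact ⟨s, hUI hs, t, ht.imp (fun h => hPI h) (fun h => hQI h), hst⟩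

/-- Adjacent vertices equidistant from `x` have the same strict predecessors towards `x`. -/
lemma DistHereditary.mem_interval_of_adj (hconn : G.Connected) (hdh : DistHereditary G)
    {x p q t : V} (hpq : G.dist p q = 1) (hlev : G.dist x p = G.dist x q)
    (ht : t ∈ interval G x p) (htp : t ≠ p) : t ∈ interval G x q := by
  obtain ⟨P, hP, hxP, htP, hPI⟩ := exists_connected_subset_interval hconn x t
  obtain ⟨Q, hQ, htQ, hpQ, hQI⟩ := exists_connected_subset_interval hconn t p
  obtain ⟨s, hs, r, hr, hsr, hlen⟩ := hdh.exists_crossing hconn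
    (induce_union_connected hP.preconnected hQ.preconnected ⟨t, htP, htQ⟩)
    (induce_pair_connected_of_adj (dist_eq_one_iff_adj.mp hpq))
    ⟨p, Or.inr hpQ, Set.mem_insert _ _⟩ (Or.inl hxP) (Set.mem_insert_of_mem p rfl)
  have tri (a b c : V) : G.dist a c ≤ G.dist a b + G.dist b c := hconn.dist_triangle
  have htp' := hconn.pos_dist_of_ne htp
  change G.dist x t + G.dist t p = G.dist x p at ht
  change G.dist x t + G.dist t q = G.dist x q
  have h₁ := tri x t q
  have h₂ := tri t s q
  rcases hr with rfl | hr
  · have := tri x s r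
    omega
  · rw [Set.mem_singleton_iff] at hr
    subst hr
    rw [dist_self] at hlen
    rcases hs with hs | hs
    · have hs' : G.dist x s + G.dist s t = G.dist x t := hPI hs
      have := G.dist_comm (u := s) (v := t)
      omega
    · have hs' : G.dist t s + G.dist s p = G.dist t p := hQI hs
      have := tri x s p
      have := tri x t s
      have := tri s r p
      have := G.dist_comm (u := p) (v := r)
      omega

/-- Shortest paths from `x` to `v` and to `y` branch either at a vertex or along an edge whose
ends are equidistant from `x`. -/
lemma DistHereditary.exists_branching (hconn : G.Connected) (hdh : DistHereditary G) (x v y : V) :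
    (∃ p, p ∈ interval G x v ∧ p ∈ interval G x y ∧ p ∈ interval G v y) ∨
    ∃ q p, q ∈ interval G x v ∧ p ∈ interval G x y ∧ G.dist p q = 1 ∧
      G.dist x p = G.dist x q ∧ G.dist v q + 1 + G.dist p y = G.dist v y := by
  obtain ⟨s, hs, t, ht, hst, hlen⟩ := hdh.exists_crossing_through hconn x v x y
  have tri (a b c : V) : G.dist a c ≤ G.dist a b + G.dist b c := hconn.dist_triangle
  have ht' : t ∈ interval G x y := by
    rcases ht with ht | ht
    · simp only [interval, Set.mem_ofPred_eq, dist_self] at ht ⊢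
      have := G.dist_comm (u := x) (v := t)
      obtain rfl : x = t := (hconn x t).dist_eq_zero_iff.mp (by omega)
      simp
    · exact ht
  simp only [interval, Set.mem_ofPred_eq] at hs ht' ⊢
  have h₁ := G.dist_comm (u := s) (v := t)
  have h₂ := tri x s t
  have h₃ := tri x t s
  have h₄ := tri t s v
  have h₅ := tri s t y
  have h₆ := tri x t v
  have h₇ := tri x s y
  have h₈ := tri v t y
  have h₉ := tri v s y
  have h₁₀ := G.dist_comm (u := s) (v := v)
  have h₁₁ := G.dist_comm (u := t) (v := v)
  by_cases h : G.dist s t = 1 ∧ G.dist x s = G.dist x t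
  · exact Or.inr ⟨s, t, hs, ht', by omega, by omega, by omega⟩
  · by_cases h' : G.dist x t ≤ G.dist x s
    · refine Or.inl ⟨t, ?_, ?_, ?_⟩ <;> omega
    · refine Or.inl ⟨s, ?_, ?_, ?_⟩ <;> omega

lemma DistHereditary.four_point_of_le (hconn : G.Connected) (hdh : DistHereditary G)
    {x y u v : V} (h₁ : G.dist u y + G.dist x v < G.dist x y + G.dist u v)
    (hle : G.dist x u + G.dist v y ≤ G.dist u y + G.dist x v) :
    G.dist x u + G.dist v y = G.dist u y + G.dist x v ∧
      G.dist x y + G.dist u v ≤ G.dist u y + G.dist x v + 2 := by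
  have tri (a b c : V) : G.dist a c ≤ G.dist a b + G.dist b c := hconn.dist_triangle
  have comm (a b : V) : G.dist a b = G.dist b a := G.dist_comm
  rcases hdh.exists_branching hconn x v y with
    ⟨p, hpv, hpy, hp⟩ | ⟨q, p, hqv, hpy, hpq, hlev, hp⟩
  · obtain ⟨s, hs, t, ht, hst, hlen⟩ := hdh.exists_crossing_through hconn x u p y
    simp only [interval, Set.mem_ofPred_eq] at hpv hpy hp hs ht
    have := comm s u
    have := comm t s
    have := comm p v
    have := tri u s v
    have := tri s t v
    have := tri t p v
    have := tri x s t
    have := tri x t s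
    have := tri x t y
    have := tri x p t
    rcases ht with ht | ht
    · have := tri t p y
      omega
    · have := tri s p v
      have := tri s t p
      have := comm p t
      by_cases h0 : G.dist p t = 0
      · omega
      · constructor <;> omega
  · obtain ⟨s, hs, t, ht, hst, hlen⟩ := hdh.exists_crossing_through hconn x u p y
    have below {r : V} (hr : r ∈ interval G x p) (hrp : r ≠ p) :
        G.dist x r + G.dist r q = G.dist x q :=
      hdh.mem_interval_of_adj hconn hpq hlev hr hrp
    by_cases htp : t = p
    · subst htp
      by_cases hsx : s ∈ interval G x t ∧ s ≠ t
      · have := below hsx.1 hsx.2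
        simp only [interval, Set.mem_ofPred_eq] at hqv hpy hs hsx
        have := comm s u
        have := tri u s v
        have := tri s q v
        omega
      · simp only [interval, Set.mem_ofPred_eq] at hqv hpy hs hsx
        have := comm s u
        have := comm t s
        have := comm q v
        have := tri u s v
        have := tri s t v
        have := tri t q v
        have := tri x s t
        have := tri x t s
        by_cases hst' : s = t
        · have : G.dist s t = 0 := hst' ▸ dist_self
          subst hst'
          constructor <;> omega
        · have : ¬ (G.dist x s + G.dist s t = G.dist x t) := fun h => hsx ⟨h, hst'⟩
          constructor <;> omega
    · have htp' := hconn.pos_dist_of_ne htp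
      have := comm s u
      have := comm t p
      have := tri u s v
      have := tri s t v
      have := tri t q v
      have := tri x s t
      have := tri x t s
      have := comm t s
      have := comm q v
      rcases ht with ht | ht
      · have := below ht htp
        simp only [interval, Set.mem_ofPred_eq] at hqv hpy hs ht
        have := tri x t y
        omega
      · simp only [interval, Set.mem_ofPred_eq] at hqv hpy hs ht
        have := tri x t y
        have := tri x p t
        omega

/-- The four-point condition of distance-hereditary graphs: if one of the three distance sums of
four vertices is the strictly largest one, then the other two are equal, and they are smaller by
at most `2`. -/
lemma DistHereditary.four_point (hconn : G.Connected) (hdh : DistHereditary G)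
    {x y u v : V} (h₁ : G.dist u y + G.dist x v < G.dist x y + G.dist u v)
    (h₂ : G.dist x u + G.dist v y < G.dist x y + G.dist u v) :
    G.dist x u + G.dist v y = G.dist u y + G.dist x v ∧
      G.dist x y + G.dist u v ≤ G.dist u y + G.dist x v + 2 := by
  rcases le_total (G.dist x u + G.dist v y) (G.dist u y + G.dist x v) with h | h
  · exact hdh.four_point_of_le hconn h₁ h
  · have hc := G.dist_comm (u := u) (v := v)
    have := hdh.four_point_of_le hconn (x := x) (y := y) (u := v) (v := u)
      (by omega) (by omega)
    omega

section Eccentricity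

variable [Fintype V]

lemma dist_le_ecc_s10 (G : SimpleGraph V) (u v : V) : G.dist u v ≤ ecc G u :=
  Finset.le_sup (f := fun w => G.dist u w) (Finset.mem_univ v)

lemma exists_dist_eq_ecc (G : SimpleGraph V) (u : V) : ∃ v, G.dist u v = ecc G u := by
  obtain ⟨v, -, hv⟩ := Finset.exists_mem_eq_sup Finset.univ ⟨u, Finset.mem_univ u⟩
    (fun w => G.dist u w)
  exact ⟨v, hv.symm⟩

/-- If the eccentricity of `u` exceeds both distances from `u` to a mutually distant pair, then
it exceeds each of them by at most `2`. -/
lemma DistHereditary.ecc_le_of_lt (hconn : G.Connected) (hdh : DistHereditary G) {x y u : V}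
    (hxy : G.dist x y = ecc G x) (hyx : G.dist y x = ecc G y)
    (hx : G.dist x u < ecc G u) (hy : G.dist y u < ecc G u) :
    ecc G u ≤ G.dist x u + 2 ∧ ecc G u ≤ G.dist y u + 2 := by
  obtain ⟨v, hv⟩ := exists_dist_eq_ecc G u
  have h₁ := dist_le_ecc_s10 G x v
  have h₂ := dist_le_ecc_s10 G y v
  have h₃ := G.dist_comm (u := x) (v := y)
  have h₄ := G.dist_comm (u := v) (v := y)
  have h₅ := G.dist_comm (u := u) (v := y)
  have := hdh.four_point hconn (x := x) (y := y) (u := u) (v := v) (by omega) (by omega)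
  omega

lemma DistHereditary.two_mul_rad_le (hconn : G.Connected) (hdh : DistHereditary G) {x y : V}
    (hxy : G.dist x y = ecc G x) (hyx : G.dist y x = ecc G y) :
    2 * rad G ≤ G.dist x y + 3 ∧ (G.dist x y % 2 = 0 → 2 * rad G ≤ G.dist x y + 2) := by
  have hrad (c : V) : rad G ≤ ecc G c := Nat.sInf_le ⟨c, rfl⟩
  by_cases h0 : G.dist x y = 0
  · have := hrad x
    omega
  obtain ⟨c, hc, hk⟩ := exists_mem_intervalSlice hconn x y (k := G.dist x y / 2 + 1) (by omega)
  change G.dist x c + G.dist c y = G.dist x y at hc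
  have := G.dist_comm (u := c) (v := y)
  have := hrad c
  by_cases h : G.dist x c < ecc G c ∧ G.dist y c < ecc G c
  · have := hdh.ecc_le_of_lt hconn hxy hyx h.1 h.2
    omega
  · omega

end Eccentricity

end DistanceHereditary

/-- Let `x,y` be mutually distant and `u` any vertex.
(i) If `|d(x,u) − d(y,u)| ≥ 2` then `e(u) = max{d(x,u), d(y,u)}`.
(ii) If `|d(x,u) − d(y,u)| = 1` or `u ∈ C(G)`, then
`max{d(x,u), d(y,u)} ≤ e(u) ≤ max{d(x,u), d(y,u)} + 1`. -/
theorem ecc_from_mutually_distant_pair {V : Type*} [Fintype V] (G : SimpleGraph V)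
    (hconn : G.Connected) (hdh : DistHereditary G) (x y u : V)
    (hxy : G.dist x y = ecc G x) (hyx : G.dist y x = ecc G y) :
    ((2 : ℤ) ≤ |(G.dist x u : ℤ) - (G.dist y u : ℤ)| →
      ecc G u = max (G.dist x u) (G.dist y u)) ∧
    ((|(G.dist x u : ℤ) - (G.dist y u : ℤ)| = 1 ∨ u ∈ center G) →
      max (G.dist x u) (G.dist y u) ≤ ecc G u ∧
      ecc G u ≤ max (G.dist x u) (G.dist y u) + 1) := by
  have hux : G.dist x u ≤ ecc G u := G.dist_comm (u := u) (v := x) ▸ dist_le_ecc_s10 G u x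
  have huy : G.dist y u ≤ ecc G u := G.dist_comm (u := u) (v := y) ▸ dist_le_ecc_s10 G u y
  have key := hdh.ecc_le_of_lt hconn (u := u) hxy hyx
  refine ⟨fun h => ?_, fun h => ⟨max_le hux huy, ?_⟩⟩
  · rcases le_abs.mp h with h | h <;> omega
  · rcases h with h | h
    · rcases eq_or_eq_neg_of_abs_eq h with h | h <;> omega
    · have hrad := hdh.two_mul_rad_le hconn hxy hyx
      change ecc G u = rad G at h
      have := hconn.dist_triangle (u := x) (v := u) (w := y)
      have := G.dist_comm (u := u) (v := y)
      omega
end
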